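/- arXiv:1502.05298 — 2 statements merged into one kernel-verified Lean document; each statement's English description precedes it below -/
import Mathlib

section
/- Let L be the Laplacian matrix of a connected undirected simple graph G on n ≥ 1 vertices and let M be a Moore–Penrose pseudoinverse of L. Let α > 0, let c : ℝ → ℝⁿ, K₂ : ℝ → ℝ^{n×n} (entrywise nonnegative), and K₁(t) = diag with k_{1,i}(t) = Σ_j k_{2,ij}(t) be differentiable with 1ₙᵀK₂(t)1ₙ > 0 for all t, and set ε(t) = (1ₙᵀK₂(t)c(t))/(1ₙᵀK₂(t)1ₙ) and L_c(t) = (K₁(t)1ₙ1ₙᵀ)/(1ₙᵀK₂(t)1ₙ) − Iₙ. Suppose x, ξ : ℝ → ℝⁿ are differentiable and satisfy ẋ(t) = −αLx(t) + Lξ(t) − αK₁(t)x(t) + αK₂(t)c(t). Define δ(t) = x(t) − ε(t)1ₙ and e(t) = ξ(t) − αM L_c(t)K₂(t)c(t). Then δ satisfies δ̇(t) = −α(L + K₁(t))δ(t) + L e(t) − ε̇(t)1ₙ for all t. -/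
open Matrix

/-- If `M` is an inner inverse of the Laplacian of a connected graph and `L M` is symmetric, then
`L M` fixes every vector whose entries sum to zero. -/
theorem SimpleGraph.lapMatrix_mul_mulVec_of_sum_eq_zero {V : Type*} [Fintype V] [DecidableEq V]
    {G : SimpleGraph V} [DecidableRel G.Adj] (hG : G.Connected) {M : Matrix V V ℝ}
    (hLML : G.lapMatrix ℝ * M * G.lapMatrix ℝ = G.lapMatrix ℝ)
    (hLM : (G.lapMatrix ℝ * M)ᵀ = G.lapMatrix ℝ * M) {v : V → ℝ} (hv : ∑ i, v i = 0) :
    G.lapMatrix ℝ *ᵥ (M *ᵥ v) = v := by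
  have hL : (G.lapMatrix ℝ)ᵀ = G.lapMatrix ℝ := G.isSymm_lapMatrix ℝ
  have hLLM : G.lapMatrix ℝ * (G.lapMatrix ℝ * M) = G.lapMatrix ℝ := by
    have := congrArg Matrix.transpose hLML
    rwa [Matrix.transpose_mul, hLM, hL] at this
  set w := v - G.lapMatrix ℝ *ᵥ (M *ᵥ v) with hw
  have hker : G.lapMatrix ℝ *ᵥ w = 0 := by
    rw [hw, Matrix.mulVec_sub, Matrix.mulVec_mulVec, Matrix.mulVec_mulVec, Matrix.mul_assoc,
      hLLM, sub_self]
  have hconst : ∀ i j, w i = w j := fun i j =>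
    (SimpleGraph.lapMatrix_mulVec_eq_zero_iff_forall_reachable G).1 hker i j (hG.preconnected i j)
  have hone : (fun _ => (1 : ℝ)) ᵥ* G.lapMatrix ℝ = 0 := by
    rw [← Matrix.mulVec_transpose, hL]
    exact G.lapMatrix_mulVec_const_eq_zero
  have hsum : ∑ i, w i = 0 := by
    have h : (fun _ => (1 : ℝ)) ⬝ᵥ (G.lapMatrix ℝ *ᵥ (M *ᵥ v)) = 0 := by
      rw [Matrix.dotProduct_mulVec, hone, zero_dotProduct]
    simp only [dotProduct, one_mul] at h
    simp only [hw, Pi.sub_apply, Finset.sum_sub_distrib, hv, h, sub_zero]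
  have hzero : w = 0 := by
    funext i
    have := hG.nonempty
    rw [Finset.sum_congr rfl fun j _ => hconst j i] at hsum
    simpa using hsum
  exact (sub_eq_zero.1 hzero).symm

/-- The error `δ(t) = x(t) − ε(t) 1ₙ` between the agents' states and the weighted average of
the sensed exogenous inputs satisfies the error dynamics
`δ̇(t) = −α (L + K₁(t)) δ(t) + L e(t) − ε̇(t) 1ₙ`, where
`e(t) = ξ(t) − α L⁺ L_c(t) K₂(t) c(t)`. -/
theorem delta_error_dynamics {n : ℕ} (hn : 1 ≤ n)
    (G : SimpleGraph (Fin n)) [DecidableRel G.Adj] (hG : G.Connected)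
    (M : Matrix (Fin n) (Fin n) ℝ)
    (h1 : G.lapMatrix ℝ * M * G.lapMatrix ℝ = G.lapMatrix ℝ)
    (h2 : M * G.lapMatrix ℝ * M = M)
    (h3 : (G.lapMatrix ℝ * M)ᵀ = G.lapMatrix ℝ * M)
    (h4 : (M * G.lapMatrix ℝ)ᵀ = M * G.lapMatrix ℝ)
    (α : ℝ) (hα : 0 < α)
    (c : ℝ → Fin n → ℝ) (hc : Differentiable ℝ c)
    (K₂ : ℝ → Matrix (Fin n) (Fin n) ℝ)
    (hK₂ : ∀ i j, Differentiable ℝ fun t => K₂ t i j)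
    (hK₂nn : ∀ t i j, 0 ≤ K₂ t i j)
    (hpos : ∀ t, 0 < (fun _ => (1 : ℝ)) ⬝ᵥ (K₂ t *ᵥ fun _ => (1 : ℝ)))
    (K₁ : ℝ → Matrix (Fin n) (Fin n) ℝ)
    (hK₁ : ∀ t, K₁ t = Matrix.diagonal fun i => ∑ j, K₂ t i j)
    (ε : ℝ → ℝ)
    (hε : ∀ t, ε t = ((fun _ => (1 : ℝ)) ⬝ᵥ (K₂ t *ᵥ c t)) /
      ((fun _ => (1 : ℝ)) ⬝ᵥ (K₂ t *ᵥ fun _ => (1 : ℝ))))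
    (Lc : ℝ → Matrix (Fin n) (Fin n) ℝ)
    (hLc : ∀ t, Lc t = ((fun _ => (1 : ℝ)) ⬝ᵥ (K₂ t *ᵥ fun _ => (1 : ℝ)))⁻¹ •
      Matrix.vecMulVec (K₁ t *ᵥ fun _ => (1 : ℝ)) (fun _ => (1 : ℝ)) - 1)
    (x ξ : ℝ → Fin n → ℝ) (hξ : Differentiable ℝ ξ)
    (hxdyn : ∀ t, HasDerivAt x
      (-(α • (G.lapMatrix ℝ *ᵥ x t)) + G.lapMatrix ℝ *ᵥ ξ t
        - α • (K₁ t *ᵥ x t) + α • (K₂ t *ᵥ c t)) t)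
    (δ e : ℝ → Fin n → ℝ)
    (hδ : ∀ t, δ t = x t - ε t • fun _ => (1 : ℝ))
    (he : ∀ t, e t = ξ t - α • (M *ᵥ ((Lc t * K₂ t) *ᵥ c t))) :
    ∀ t, HasDerivAt δ
      (-(α • ((G.lapMatrix ℝ + K₁ t) *ᵥ δ t)) + G.lapMatrix ℝ *ᵥ e t
        - deriv ε t • fun _ => (1 : ℝ)) t := by
  intro t
  have hK₁one : K₁ t *ᵥ (fun _ => (1 : ℝ)) = K₂ t *ᵥ fun _ => (1 : ℝ) := by
    funext i
    rw [hK₁, Matrix.mulVec_diagonal]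
    simp [Matrix.mulVec, dotProduct]
  have hv : (Lc t * K₂ t) *ᵥ c t = ε t • (K₁ t *ᵥ fun _ => (1 : ℝ)) - K₂ t *ᵥ c t := by
    rw [← Matrix.mulVec_mulVec, hLc, Matrix.sub_mulVec, Matrix.smul_mulVec, Matrix.one_mulVec,
      Matrix.vecMulVec_mulVec, hε, div_eq_inv_mul, ← smul_smul, op_smul_eq_smul]
  have hsum : ∑ i, ((Lc t * K₂ t) *ᵥ c t) i = 0 := by
    have h : (fun _ => (1 : ℝ)) ⬝ᵥ ((Lc t * K₂ t) *ᵥ c t) = 0 := by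
      rw [hv, hK₁one, dotProduct_sub, dotProduct_smul, hε, smul_eq_mul,
        div_mul_cancel₀ _ (hpos t).ne', sub_self]
    simpa only [dotProduct, one_mul] using h
  have hLMv := SimpleGraph.lapMatrix_mul_mulVec_of_sum_eq_zero hG h1 h3 hsum
  have hLone : G.lapMatrix ℝ *ᵥ (fun _ => (1 : ℝ)) = 0 := G.lapMatrix_mulVec_const_eq_zero
  have hεdiff : DifferentiableAt ℝ ε t := by
    rw [funext hε]
    refine DifferentiableAt.div ?_ ?_ (hpos t).ne'
    · simp only [dotProduct, Matrix.mulVec]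
      fun_prop
    · simp only [dotProduct, Matrix.mulVec]
      fun_prop
  rw [funext hδ]
  refine ((hxdyn t).sub (hεdiff.hasDerivAt.smul_const fun _ => (1 : ℝ))).congr_deriv ?_
  simp only [he, Matrix.mulVec_sub, Matrix.mulVec_smul, hLMv, Matrix.add_mulVec, hLone]
  rw [hv]
  module
end

section
/- (Corollary 3 in original coordinates.) Let L be the Laplacian matrix of a connected undirected simple graph G on n ≥ 1 vertices, let M be a Moore–Penrose pseudoinverse of L, let α, γ > 0, let c ∈ ℝⁿ be a constant input vector, let K₂ ∈ ℝ^{n×n} be a constant matrix with nonnegative entries and 1ₙᵀK₂1ₙ > 0, and let K₁ = diag(k_{1,1},…,k_{1,n}) with k_{1,i} = Σ_j k_{2,ij}. Set ε = (1ₙᵀK₂c)/(1ₙᵀK₂1ₙ) and L_c = (K₁1ₙ1ₙᵀ)/(1ₙᵀK₂1ₙ) − Iₙ. If x, ξ : ℝ → ℝⁿ are differentiable and satisfy ẋ(t) = −αLx(t) + Lξ(t) − αK₁x(t) + αK₂c and ξ̇(t) = −γLx(t), then x(t) → ε·1ₙ as t → ∞; that is, the state of every agent converges to the weighted average of the sensed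 exogenous inputs. -/
open Matrix

/-- A function that is antitone and nonnegative on `[0, ∞)` converges at infinity. -/
lemma AntitoneOn.exists_tendsto_atTop_of_nonneg {g : ℝ → ℝ} (hg : AntitoneOn g (Set.Ici 0))
    (h0 : ∀ t, 0 ≤ t → 0 ≤ g t) : ∃ l, Filter.Tendsto g Filter.atTop (nhds l) := by
  have hanti : Antitone fun t => g (max 0 t) := fun s t hst =>
    hg (Set.mem_Ici.2 (le_max_left _ _)) (Set.mem_Ici.2 (le_max_left _ _)) (max_le_max le_rfl hst)
  have hbdd : BddBelow (Set.range fun t => g (max 0 t)) :=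
    ⟨0, by rintro _ ⟨t, rfl⟩; exact h0 _ (le_max_left _ _)⟩
  refine ⟨_, (tendsto_atTop_ciInf hanti hbdd).congr' ?_⟩
  filter_upwards [Filter.eventually_ge_atTop 0] with t ht
  rw [max_eq_right ht]

/-- A function whose derivative is nonpositive on `[0, ∞)` is antitone there. -/
lemma antitoneOn_Ici_of_hasDerivAt_nonpos {g g' : ℝ → ℝ} (hg : ∀ t, HasDerivAt g (g' t) t)
    (hg' : ∀ t, 0 ≤ t → g' t ≤ 0) : AntitoneOn g (Set.Ici 0) := by
  refine antitoneOn_of_deriv_nonpos (convex_Ici 0)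
    (fun t _ => (hg t).continuousAt.continuousWithinAt)
    (fun t _ => (hg t).differentiableAt.differentiableWithinAt) fun t ht => ?_
  rw [interior_Ici] at ht
  rw [(hg t).deriv]
  exact hg' t (le_of_lt ht)

/-- A Barbalat-type lemma: if `V ≥ 0` decreases at rate `k f` with `f ≥ 0`, and `f` has bounded
derivative, then `f` tends to zero. -/
lemma tendsto_zero_of_hasDerivAt_neg_mul {V f f' : ℝ → ℝ} {k C : ℝ} (hk : 0 < k)
    (hV : ∀ t, HasDerivAt V (-(k * f t)) t) (hf : ∀ t, HasDerivAt f (f' t) t)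
    (hV0 : ∀ t, 0 ≤ V t) (hf0 : ∀ t, 0 ≤ f t) (hC : ∀ t, 0 ≤ t → |f' t| ≤ C) :
    Filter.Tendsto f Filter.atTop (nhds 0) := by
  have hC0 : 0 ≤ C := (abs_nonneg _).trans (hC 0 le_rfl)
  obtain ⟨v, hv⟩ := (antitoneOn_Ici_of_hasDerivAt_nonpos hV fun t _ => by
    have := mul_nonneg hk.le (hf0 t); linarith).exists_tendsto_atTop_of_nonneg fun t _ => hV0 t
  have hW : ∀ t, HasDerivAt (fun t => f t ^ 2 + 2 * C / k * V t)
      (2 * f t * f' t + 2 * C / k * -(k * f t)) t := fun t => by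
    convert! ((hf t).pow 2).add ((hV t).const_mul (2 * C / k)) using 1
    simp
  obtain ⟨w, hw⟩ := (antitoneOn_Ici_of_hasDerivAt_nonpos hW fun t ht => by
    have h1 : 2 * C / k * -(k * f t) = -(2 * C * f t) := by field_simp
    have h2 := mul_le_mul_of_nonneg_left ((le_abs_self _).trans (hC t ht)) (hf0 t)
    rw [h1]; linarith).exists_tendsto_atTop_of_nonneg fun t _ => by
      have := hV0 t
      positivity
  have hsq : Filter.Tendsto (fun t => f t ^ 2) Filter.atTop (nhds (w - 2 * C / k * v)) := by
    simpa using hw.sub (hv.const_mul (2 * C / k))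
  have hsqrt := (Real.continuous_sqrt.tendsto _).comp hsq
  have hlim : Filter.Tendsto f Filter.atTop (nhds √(w - 2 * C / k * v)) :=
    hsqrt.congr fun t => Real.sqrt_sq (hf0 t)
  have hmean : ∀ t : ℝ, ∃ s, t < s ∧ -(k * f s) = V (t + 1) - V t := fun t => by
    obtain ⟨s, hs, h⟩ := exists_hasDerivAt_eq_slope V (fun s => -(k * f s)) (lt_add_one t)
      (fun s _ => (hV s).continuousAt.continuousWithinAt) fun s _ => hV s
    exact ⟨s, hs.1, by simpa using h⟩
  choose s hs hsV using hmean
  have hs_top : Filter.Tendsto s Filter.atTop Filter.atTop :=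
    Filter.tendsto_atTop_mono (fun t => (hs t).le) Filter.tendsto_id
  have hdiff : Filter.Tendsto (fun t => V (t + 1) - V t) Filter.atTop (nhds 0) := by
    simpa using (hv.comp (Filter.tendsto_atTop_add_const_right _ 1 Filter.tendsto_id)).sub hv
  have hlim' := (((hlim.comp hs_top).const_mul k).neg).congr hsV
  have h0 := tendsto_nhds_unique hlim' hdiff
  have h1 : √(w - 2 * C / k * v) = 0 := by
    simpa [hk.ne'] using h0
  rwa [h1] at hlim

/-- The product rule for the dot product of two curves. -/
lemma HasDerivAt.dotProduct {ι : Type*} [Fintype ι] {u v : ℝ → ι → ℝ} {u' v' : ι → ℝ} {t : ℝ}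
    (hu : HasDerivAt u u' t) (hv : HasDerivAt v v' t) :
    HasDerivAt (fun t => u t ⬝ᵥ v t) (u' ⬝ᵥ v t + u t ⬝ᵥ v') t := by
  have := HasDerivAt.fun_sum (u := Finset.univ) fun i _ =>
    (hasDerivAt_pi.1 hu i).mul (hasDerivAt_pi.1 hv i)
  rw [Finset.sum_add_distrib] at this
  exact this

/-- A constant matrix can be pulled out of the derivative of a curve. -/
lemma HasDerivAt.const_mulVec {m ι : Type*} [Fintype m] [Fintype ι] {u : ℝ → ι → ℝ} {u' : ι → ℝ}
    {t : ℝ} (A : Matrix m ι ℝ) (hu : HasDerivAt u u' t) :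
    HasDerivAt (fun t => A *ᵥ u t) (A *ᵥ u') t :=
  (LinearMap.toContinuousLinearMap A.mulVecLin).hasFDerivAt.comp_hasDerivAt t hu

lemma mem_Icc_of_dotProduct_self_le {ι : Type*} [Fintype ι] {v : ι → ℝ} {R : ℝ}
    (h : v ⬝ᵥ v ≤ R) : v ∈ Set.Icc (fun _ : ι => -(R + 1)) (fun _ : ι => R + 1) := by
  have hi : ∀ i, v i * v i ≤ R := fun i =>
    (Finset.single_le_sum (f := fun i => v i * v i) (fun j _ => mul_self_nonneg _)
      (Finset.mem_univ i)).trans h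
  constructor <;> intro i <;> have := hi i <;> nlinarith

/-- Asymptotic stability of the interconnection `ẏ = -αPy + Lη`, `η̇ = -γLy` in the `y`-variable,
for symmetric `L` and positive definite quadratic form of `P`. -/
lemma tendsto_zero_of_saddle_dynamics {ι : Type*} [Fintype ι] {P L : Matrix ι ι ℝ}
    (hP : ∀ v, 0 ≤ v ⬝ᵥ (P *ᵥ v)) (hP0 : ∀ v, v ⬝ᵥ (P *ᵥ v) = 0 → v = 0) (hL : Lᵀ = L)
    {α γ : ℝ} (hα : 0 < α) (hγ : 0 < γ) {y η : ℝ → ι → ℝ}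
    (hy : ∀ t, HasDerivAt y (-(α • (P *ᵥ y t)) + L *ᵥ η t) t)
    (hη : ∀ t, HasDerivAt η (-(γ • (L *ᵥ y t))) t) :
    Filter.Tendsto y Filter.atTop (nhds 0) := by
  have hnn : ∀ v : ι → ℝ, 0 ≤ v ⬝ᵥ v := fun v =>
    Finset.sum_nonneg fun i _ => mul_self_nonneg (v i)
  have hsymm : ∀ u v : ι → ℝ, u ⬝ᵥ (L *ᵥ v) = v ⬝ᵥ (L *ᵥ u) := fun u v => by
    rw [dotProduct_mulVec, ← mulVec_transpose, hL, dotProduct_comm]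
  let V : ℝ → ℝ := fun t => γ * (y t ⬝ᵥ y t) + η t ⬝ᵥ η t
  have hV : ∀ t, HasDerivAt V (-(2 * α * γ * (y t ⬝ᵥ (P *ᵥ y t)))) t := fun t => by
    refine ((((hy t).dotProduct (hy t)).const_mul γ).add ((hη t).dotProduct (hη t))).congr_deriv ?_
    rw [dotProduct_comm _ (y t), dotProduct_comm _ (η t)]
    simp only [dotProduct_add, dotProduct_neg, dotProduct_smul, smul_eq_mul, hsymm (y t) (η t)]
    ring
  have hV0 : ∀ t, 0 ≤ V t := fun t => add_nonneg (mul_nonneg hγ.le (hnn _)) (hnn _)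
  have hk : 0 < 2 * α * γ := by positivity
  have hVanti : AntitoneOn V (Set.Ici 0) := antitoneOn_Ici_of_hasDerivAt_nonpos hV fun t _ => by
    have := mul_nonneg hk.le (hP (y t)); linarith
  let K (R : ℝ) : Set (ι → ℝ) := Set.Icc (fun _ => -(R + 1)) (fun _ => R + 1)
  have hyK : ∀ t, 0 ≤ t → y t ∈ K (V 0 / γ) := fun t ht => by
    refine mem_Icc_of_dotProduct_self_le ?_
    rw [le_div_iff₀ hγ]
    have h1 : V t ≤ V 0 := hVanti Set.self_mem_Ici ht ht
    have h2 : V t = γ * (y t ⬝ᵥ y t) + η t ⬝ᵥ η t := rfl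
    have := hnn (η t)
    linarith
  have hηK : ∀ t, 0 ≤ t → η t ∈ K (V 0) := fun t ht => by
    refine mem_Icc_of_dotProduct_self_le ?_
    have h1 : V t ≤ V 0 := hVanti Set.self_mem_Ici ht ht
    have h2 : V t = γ * (y t ⬝ᵥ y t) + η t ⬝ᵥ η t := rfl
    have := mul_nonneg hγ.le (hnn (y t))
    linarith
  let φ : (ι → ℝ) × (ι → ℝ) → ℝ := fun p =>
    (-(α • (P *ᵥ p.1)) + L *ᵥ p.2) ⬝ᵥ (P *ᵥ p.1) +
      p.1 ⬝ᵥ (P *ᵥ (-(α • (P *ᵥ p.1)) + L *ᵥ p.2))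
  have hφ : Continuous φ := by fun_prop
  obtain ⟨C, hC⟩ := ((isCompact_Icc : IsCompact (K (V 0 / γ))).prod
    (isCompact_Icc : IsCompact (K (V 0)))).exists_bound_of_continuousOn hφ.continuousOn
  have hlim : Filter.Tendsto (fun t => y t ⬝ᵥ (P *ᵥ y t)) Filter.atTop (nhds 0) :=
    tendsto_zero_of_hasDerivAt_neg_mul (f' := fun t => φ (y t, η t)) hk hV
      (fun t => (hy t).dotProduct ((hy t).const_mulVec P)) hV0 (fun t => hP _)
      fun t ht => hC _ ⟨hyK t ht, hηK t ht⟩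
  refine (isCompact_Icc : IsCompact (K (V 0 / γ))).tendsto_nhds_of_unique_mapClusterPt
    ((Filter.eventually_ge_atTop 0).mono hyK) fun z _ hz => hP0 z ?_
  have hq : Continuous fun v : ι → ℝ => v ⬝ᵥ (P *ᵥ v) := by fun_prop
  have hz' : MapClusterPt (z ⬝ᵥ (P *ᵥ z)) Filter.atTop (fun t => y t ⬝ᵥ (P *ᵥ y t)) :=
    hz.continuousAt_comp hq.continuousAt
  exact eq_of_nhds_neBot (hz'.clusterPt.mono hlim)

/-- A vector in the kernel of the Laplacian of a connected graph is constant. -/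
lemma SimpleGraph.Connected.eq_of_lapMatrix_mulVec_eq_zero {V : Type*} [Fintype V] [DecidableEq V]
    {G : SimpleGraph V} [DecidableRel G.Adj] (hG : G.Connected) {v : V → ℝ}
    (hv : G.lapMatrix ℝ *ᵥ v = 0) (i j : V) : v i = v j :=
  (G.lapMatrix_mulVec_eq_zero_iff_forall_reachable.1 hv) i j (hG.preconnected i j)

/-- The Laplacian of a connected graph, given a generalized inverse `M` for which `L * M` is
symmetric, has every zero-sum vector in its range. -/
lemma SimpleGraph.Connected.lapMatrix_mulVec_mulVec_of_sum_eq_zero {V : Type*} [Fintype V]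
    [DecidableEq V] {G : SimpleGraph V} [DecidableRel G.Adj] (hG : G.Connected) {M : Matrix V V ℝ}
    (h1 : G.lapMatrix ℝ * M * G.lapMatrix ℝ = G.lapMatrix ℝ)
    (h3 : (G.lapMatrix ℝ * M)ᵀ = G.lapMatrix ℝ * M) {b : V → ℝ} (hb : ∑ i, b i = 0) :
    G.lapMatrix ℝ *ᵥ (M *ᵥ b) = b := by
  have hsymm : (G.lapMatrix ℝ)ᵀ = G.lapMatrix ℝ := SimpleGraph.isSymm_lapMatrix ℝ G
  have hLLM : G.lapMatrix ℝ * (G.lapMatrix ℝ * M) = G.lapMatrix ℝ := by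
    have := congrArg transpose h1
    rwa [transpose_mul, h3, hsymm] at this
  have hr : G.lapMatrix ℝ *ᵥ (b - G.lapMatrix ℝ *ᵥ (M *ᵥ b)) = 0 := by
    rw [mulVec_sub, mulVec_mulVec, mulVec_mulVec, Matrix.mul_assoc, hLLM, sub_self]
  have hsum : ∑ i, (b - G.lapMatrix ℝ *ᵥ (M *ᵥ b)) i = 0 := by
    have h : (fun _ => (1 : ℝ)) ⬝ᵥ (G.lapMatrix ℝ *ᵥ (M *ᵥ b)) = 0 := by
      rw [dotProduct_mulVec, ← mulVec_transpose, hsymm, G.lapMatrix_mulVec_const_eq_zero,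
        zero_dotProduct]
    simp only [dotProduct, one_mul] at h
    simp only [Pi.sub_apply, Finset.sum_sub_distrib, hb, h, sub_zero]
  funext i
  have hconst : ∀ j, (b - G.lapMatrix ℝ *ᵥ (M *ᵥ b)) j = (b - G.lapMatrix ℝ *ᵥ (M *ᵥ b)) i :=
    fun j => hG.eq_of_lapMatrix_mulVec_eq_zero hr j i
  have : Nonempty V := ⟨i⟩
  simp only [hconst, Finset.sum_const, Finset.card_univ, smul_eq_zero, Fintype.card_ne_zero,
    false_or] at hsum
  exact (sub_eq_zero.1 hsum).symm

/-- The quadratic form of `L + diag k` splits. -/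
lemma dotProduct_add_diagonal_mulVec {ι : Type*} [Fintype ι] [DecidableEq ι] (L : Matrix ι ι ℝ)
    (k v : ι → ℝ) : v ⬝ᵥ ((L + diagonal k) *ᵥ v) = v ⬝ᵥ (L *ᵥ v) + ∑ i, k i * (v i * v i) := by
  rw [add_mulVec, dotProduct_add]
  congr 1
  simp only [dotProduct, mulVec_diagonal]
  exact Finset.sum_congr rfl fun i _ => by ring

lemma SimpleGraph.dotProduct_lapMatrix_mulVec_nonneg {V : Type*} [Fintype V] [DecidableEq V]
    (G : SimpleGraph V) [DecidableRel G.Adj] (v : V → ℝ) : 0 ≤ v ⬝ᵥ (G.lapMatrix ℝ *ᵥ v) := by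
  simpa using (G.posSemidef_lapMatrix ℝ).dotProduct_mulVec_nonneg v

/-- Adding nonnegative, not identically zero, self-weights to the Laplacian of a connected graph
makes its quadratic form anisotropic. -/
lemma SimpleGraph.Connected.eq_zero_of_dotProduct_lapMatrix_add_diagonal {V : Type*} [Fintype V]
    [DecidableEq V] {G : SimpleGraph V} [DecidableRel G.Adj] (hG : G.Connected) {k : V → ℝ}
    (hk : ∀ i, 0 ≤ k i) (hk0 : 0 < ∑ i, k i) {v : V → ℝ}
    (hv : v ⬝ᵥ ((G.lapMatrix ℝ + diagonal k) *ᵥ v) = 0) : v = 0 := by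
  rw [dotProduct_add_diagonal_mulVec] at hv
  have hL := G.dotProduct_lapMatrix_mulVec_nonneg v
  have hK : 0 ≤ ∑ i, k i * (v i * v i) :=
    Finset.sum_nonneg fun i _ => mul_nonneg (hk i) (mul_self_nonneg _)
  have hLv : G.lapMatrix ℝ *ᵥ v = 0 := by
    rw [← (G.posSemidef_lapMatrix ℝ).dotProduct_mulVec_zero_iff, star_trivial]
    linarith
  have hconst := hG.eq_of_lapMatrix_mulVec_eq_zero hLv
  funext i
  have hsum : (∑ j, k j) * (v i * v i) = 0 := by
    rw [Finset.sum_mul, ← (by linarith : ∑ j, k j * (v j * v j) = 0)]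
    exact Finset.sum_congr rfl fun j _ => by rw [hconst j i]
  simpa [hk0.ne'] using hsum

/-- **Corollary 3 (original coordinates).** For constant value of information `K₂` (entrywise
nonnegative with `1ₙᵀK₂1ₙ > 0`) and constant sensed exogenous inputs `c`, the states of all
agents obeying `ẋ = −αLx + Lξ − αK₁x + αK₂c`, `ξ̇ = −γLx` converge to the weighted average
`ε 1ₙ` of the sensed exogenous inputs, where `ε = (1ₙᵀK₂c)/(1ₙᵀK₂1ₙ)`. -/
theorem states_converge_to_weighted_average {n : ℕ} (hn : 1 ≤ n)
    (G : SimpleGraph (Fin n)) [DecidableRel G.Adj] (hG : G.Connected)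
    (M : Matrix (Fin n) (Fin n) ℝ)
    (h1 : G.lapMatrix ℝ * M * G.lapMatrix ℝ = G.lapMatrix ℝ)
    (h2 : M * G.lapMatrix ℝ * M = M)
    (h3 : (G.lapMatrix ℝ * M)ᵀ = G.lapMatrix ℝ * M)
    (h4 : (M * G.lapMatrix ℝ)ᵀ = M * G.lapMatrix ℝ)
    (α γ : ℝ) (hα : 0 < α) (hγ : 0 < γ)
    (c : Fin n → ℝ) (K₂ : Matrix (Fin n) (Fin n) ℝ) (hnn : ∀ i j, 0 ≤ K₂ i j)
    (hpos : 0 < (fun _ => (1 : ℝ)) ⬝ᵥ (K₂ *ᵥ fun _ => (1 : ℝ)))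
    (K₁ : Matrix (Fin n) (Fin n) ℝ)
    (hK₁ : K₁ = Matrix.diagonal fun i => ∑ j, K₂ i j)
    (ε : ℝ)
    (hε : ε = ((fun _ => (1 : ℝ)) ⬝ᵥ (K₂ *ᵥ c)) /
      ((fun _ => (1 : ℝ)) ⬝ᵥ (K₂ *ᵥ fun _ => (1 : ℝ))))
    (Lc : Matrix (Fin n) (Fin n) ℝ)
    (hLc : Lc = ((fun _ => (1 : ℝ)) ⬝ᵥ (K₂ *ᵥ fun _ => (1 : ℝ)))⁻¹ •
      Matrix.vecMulVec (K₁ *ᵥ fun _ => (1 : ℝ)) (fun _ => (1 : ℝ)) - 1)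
    (x ξ : ℝ → Fin n → ℝ)
    (hxdyn : ∀ t, HasDerivAt x
      (-(α • (G.lapMatrix ℝ *ᵥ x t)) + G.lapMatrix ℝ *ᵥ ξ t
        - α • (K₁ *ᵥ x t) + α • (K₂ *ᵥ c)) t)
    (hξdyn : ∀ t, HasDerivAt ξ (-(γ • (G.lapMatrix ℝ *ᵥ x t))) t) :
    Filter.Tendsto x Filter.atTop (nhds (ε • fun _ => (1 : ℝ))) := by
  have hone : (fun _ => (1 : ℝ)) ⬝ᵥ (K₂ *ᵥ fun _ => (1 : ℝ)) = ∑ i, ∑ j, K₂ i j := by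
    simp [dotProduct, mulVec]
  have hk : ∀ i, 0 ≤ ∑ j, K₂ i j := fun i => Finset.sum_nonneg fun j _ => hnn i j
  have hk0 : 0 < ∑ i, ∑ j, K₂ i j := hone ▸ hpos
  have hLone : G.lapMatrix ℝ *ᵥ (ε • fun _ => (1 : ℝ)) = 0 := by
    rw [mulVec_smul, G.lapMatrix_mulVec_const_eq_zero, smul_zero]
  have hb : ∑ i, (K₂ *ᵥ c - K₁ *ᵥ (ε • fun _ => (1 : ℝ))) i = 0 := by
    have hK : ∑ i, (K₁ *ᵥ (ε • fun _ => (1 : ℝ))) i = ε * ∑ i, ∑ j, K₂ i j := by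
      simp [hK₁, mulVec_diagonal, Finset.mul_sum _ _ ε, mul_comm]
    have hc : ε * ∑ i, ∑ j, K₂ i j = ∑ i, (K₂ *ᵥ c) i := by
      rw [hε, hone, div_mul_cancel₀ _ hk0.ne']
      simp [dotProduct]
    simp only [Pi.sub_apply, Finset.sum_sub_distrib]
    rw [hK, hc, sub_self]
  have hw := hG.lapMatrix_mulVec_mulVec_of_sum_eq_zero h1 h3 hb
  have hlim : Filter.Tendsto (fun t => x t - ε • fun _ => (1 : ℝ)) Filter.atTop (nhds 0) := by
    refine tendsto_zero_of_saddle_dynamics (P := G.lapMatrix ℝ + K₁) (L := G.lapMatrix ℝ)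
      (η := fun t => ξ t + α • (M *ᵥ (K₂ *ᵥ c - K₁ *ᵥ (ε • fun _ => (1 : ℝ)))))
      (fun v => ?_) (fun v hv => ?_) (SimpleGraph.isSymm_lapMatrix ℝ G) hα hγ (fun t => ?_) (fun t => ?_)
    · rw [hK₁, dotProduct_add_diagonal_mulVec]
      exact add_nonneg (G.dotProduct_lapMatrix_mulVec_nonneg v)
        (Finset.sum_nonneg fun i _ => mul_nonneg (hk i) (mul_self_nonneg _))
    · rw [hK₁] at hv
      exact hG.eq_zero_of_dotProduct_lapMatrix_add_diagonal hk hk0 hv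
    · refine ((hxdyn t).sub_const _).congr_deriv ?_
      rw [mulVec_add, mulVec_smul _ α, hw, add_mulVec, mulVec_sub, mulVec_sub, hLone]
      module
    · refine ((hξdyn t).add_const _).congr_deriv ?_
      rw [mulVec_sub, hLone, sub_zero]
  simpa using hlim.add_const (ε • fun _ => (1 : ℝ))
end
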